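/- For every infinite-dimensional Banach space X and every infinite cardinal κ, there exists a Banach space Y with dim Y = κ such that X ≡ Y (Y is elementary equivalent to X). -/

import Mathlib

open Filter Topology
open scoped ENNReal

noncomputable section

universe u

/-- The subspace `N_D ⊆ ℓ∞(I, X)` of families whose norms tend to `0` along the
ultrafilter `D`. -/
def ultraNullIdeal (I : Type u) (D : Ultrafilter I) (X : Type u)
    [NormedAddCommGroup X] [NormedSpace ℝ X] :
    Submodule ℝ (lp (fun _ : I => X) ∞) where
  carrier := {f | Filter.Tendsto (fun i => ‖f i‖) (D : Filter I) (nhds 0)}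
  zero_mem' := by
    simpa using (tendsto_const_nhds :
      Filter.Tendsto (fun _ : I => (0 : ℝ)) (D : Filter I) (nhds 0))
  add_mem' := by
    intro f g hf hg
    have h := hf.add hg
    rw [add_zero] at h
    refine squeeze_zero (fun i => norm_nonneg _) (fun i => ?_) h
    simpa using norm_add_le (f i) (g i)
  smul_mem' := by
    intro c f hf
    have h : Filter.Tendsto (fun i => ‖c‖ * ‖f i‖) (D : Filter I) (nhds 0) := by
      simpa using hf.const_mul ‖c‖
    refine squeeze_zero (fun i => norm_nonneg _) (fun i => ?_) h
    simp [norm_smul]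

/-- The Banach-space ultrapower `(X)_D = ℓ∞(I,X) / N_D`, with the quotient norm. -/
abbrev Ultrapower (I : Type u) (D : Ultrafilter I) (X : Type u)
    [NormedAddCommGroup X] [NormedSpace ℝ X] : Type u :=
  lp (fun _ : I => X) ∞ ⧸ ultraNullIdeal I D X

/-- The bounded family constantly equal to `x`, as an element of `ℓ∞(I, X)`. -/
def constLp (I : Type u) (X : Type u) [NormedAddCommGroup X] [NormedSpace ℝ X] (x : X) :
    lp (fun _ : I => X) ∞ :=
  ⟨fun _ => x, memℓp_infty ⟨‖x‖, by rintro r ⟨i, rfl⟩; exact le_rfl⟩⟩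

/-- The canonical (diagonal) embedding `d_X : X → (X)_D`. -/
def diagEmbedding (I : Type u) (D : Ultrafilter I) (X : Type u)
    [NormedAddCommGroup X] [NormedSpace ℝ X] (x : X) : Ultrapower I D X :=
  Submodule.Quotient.mk (constLp I X x)

/-- Banach spaces `X` and `Y` are *elementary equivalent* if some ultrapowers `(X)_G` and
`(Y)_G` are isometrically isomorphic. -/
def ElemEquiv (X Y : Type u) [NormedAddCommGroup X] [NormedSpace ℝ X]
    [NormedAddCommGroup Y] [NormedSpace ℝ Y] : Prop :=
  ∃ (K : Type u) (G : Ultrafilter K),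
    Nonempty (Ultrapower K G X ≃ₗᵢ[ℝ] Ultrapower K G Y)

/-- A packaged real Banach space. -/
structure BanachSpace : Type (u + 1) where
  carrier : Type u
  [norm : NormedAddCommGroup carrier]
  [smulR : NormedSpace ℝ carrier]
  [complete : CompleteSpace carrier]

attribute [instance] BanachSpace.norm BanachSpace.smulR BanachSpace.complete

/-- The dimension of a normed space: the least cardinality of a subset whose closed linear
span is the whole space (for infinite-dimensional spaces this is the density character). -/
noncomputable def bdim (X : Type u) [SeminormedAddCommGroup X] [NormedSpace ℝ X] :
    Cardinal.{u} :=
  sInf {c : Cardinal.{u} |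
    ∃ A : Set X, Cardinal.mk A = c ∧ (Submodule.span ℝ A).topologicalClosure = ⊤}

theorem exists_forall_of_wellFounded_step {S T : Type*} [LinearOrder S] [WellFoundedLT S]
    [Nonempty T] (Q : S → (S → T) → Prop)
    (hQ : ∀ s g g', (∀ t ≤ s, g t = g' t) → Q s g → Q s g')
    (step : ∀ s g, (∀ t < s, Q t g) → ∃ x, Q s (Function.update g s x)) :
    ∃ g, ∀ s, Q s g := by
  classical
  let ext (s : S) (ih : ∀ t, t < s → T) (x : T) : S → T :=
    fun t => if h : t < s then ih t h else x
  let g : S → T := (wellFounded_lt (α := S)).fix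
    fun s ih => Classical.epsilon fun x => Q s (ext s ih x)
  have hg (s : S) : g s = Classical.epsilon fun x => Q s (ext s (fun t _ => g t) x) :=
    WellFounded.fix_eq _ _ _
  refine ⟨g, fun s => ?_⟩
  induction s using WellFoundedLT.induction with
  | ind s ih =>
    obtain ⟨x, hx⟩ := step s g ih
    have hx' : Q s (ext s (fun t _ => g t) x) := by
      refine hQ s _ _ (fun t ht => ?_) hx
      rcases ht.lt_or_eq with h | rfl
      · simp [ext, h, h.ne]
      · simp [ext]
    have key := Classical.epsilon_spec (p := fun x => Q s (ext s (fun t _ => g t) x)) ⟨x, hx'⟩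
    rw [← hg s] at key
    refine hQ s _ _ (fun t ht => ?_) key
    rcases ht.lt_or_eq with h | rfl
    · simp [ext, h]
    · simp [ext]

/-- A large family of functions, indexed by `Set (Set J)`, which is independent for conditions
prescribing the values of at most `#J` of its members. -/
theorem exists_independent_family (J : Type u) [Nonempty J] :
    ∃ ev : Set (Set J) → ((J × J → Set J) × (J → Set (J × J)) × (J → J)) → J,
      ∀ B : Set (Set (Set J)), Cardinal.mk B ≤ Cardinal.mk J → ∀ v : Set (Set J) → J,
        ∃ i, ∀ f ∈ B, ev f i = v f := by
  classical
  refine ⟨fun f i => i.2.2 (Classical.epsilon fun j => i.1 ⁻¹' f = i.2.1 j), fun B hB v => ?_⟩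
  rcases B.eq_empty_or_nonempty with rfl | ⟨f₀, hf₀⟩
  · exact ⟨⟨fun _ => ∅, fun _ => ∅, id⟩, by simp⟩
  have : Nonempty B := ⟨⟨f₀, hf₀⟩⟩
  obtain ⟨ι⟩ := Cardinal.le_def _ _ |>.1 hB
  let r : J → B := Function.invFun ι
  have hr (f : B) : r (ι f) = f := Function.leftInverse_invFun ι.injective f
  let e : J × J → Set J := fun p =>
    Classical.epsilon fun x => ¬ (x ∈ (r p.1 : Set (Set J)) ↔ x ∈ (r p.2 : Set (Set J)))
  have he (f f' : B) (h : e ⁻¹' (f : Set (Set J)) = e ⁻¹' (f' : Set (Set J))) : f = f' := by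
    by_contra hne
    have hx : ∃ x, ¬ (x ∈ (f : Set (Set J)) ↔ x ∈ (f' : Set (Set J))) := by
      by_contra! hcon
      exact hne (Subtype.ext (Set.ext hcon))
    have hspec := Classical.epsilon_spec hx
    have h' := Set.ext_iff.1 h (ι f, ι f')
    simp only [Set.mem_preimage, e, hr] at h'
    exact hspec h'
  refine ⟨⟨e, fun j => e ⁻¹' (r j : Set (Set J)), fun j => v (r j)⟩, fun f hf => ?_⟩
  have hj : ∃ j, e ⁻¹' f = e ⁻¹' (r j : Set (Set J)) := ⟨ι ⟨f, hf⟩, by rw [hr]⟩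
  have hspec := Classical.epsilon_spec hj
  have := he ⟨f, hf⟩ _ hspec
  exact congrArg v (congrArg Subtype.val this).symm

theorem exists_maximal_subset_pairwiseDisjoint {α β : Type*} (A : Set α) (f : α → Set β) :
    ∃ T ⊆ A, T.PairwiseDisjoint f ∧
      ∀ a ∈ A, (f a).Nonempty → ∃ t ∈ T, ¬ Disjoint (f t) (f a) := by
  obtain ⟨T, hT⟩ := zorn_subset {T : Set α | T ⊆ A ∧ T.PairwiseDisjoint f} (by
    intro c hc hchain
    refine ⟨⋃₀ c, ⟨Set.sUnion_subset fun t ht => (hc ht).1, ?_⟩, fun t ht =>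
      Set.subset_sUnion_of_mem ht⟩
    exact (Set.pairwiseDisjoint_sUnion hchain.directedOn).2 fun t ht => (hc ht).2)
  refine ⟨T, hT.prop.1, hT.prop.2, fun a ha hne => ?_⟩
  by_contra! hcon
  have hins : insert a T ∈ {T : Set α | T ⊆ A ∧ T.PairwiseDisjoint f} :=
    ⟨Set.insert_subset ha hT.prop.1,
      hT.prop.2.insert fun t ht _ => (hcon t ht).symm⟩
  have haT : a ∈ T := hT.le_of_ge hins (Set.subset_insert a T) (Set.mem_insert a T)
  have := hcon a haT
  rw [disjoint_self] at this
  exact hne.ne_empty this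

/-- If the functions `ev f` are independent modulo the sets `ε k` for `f ∉ W`, then one of them
agrees with each of the prescribed functions `γ k` on a large set, without spoiling the
independence of the remaining ones. -/
theorem exists_hitting {F I V K : Type u} [Nonempty V] {ν κ : Cardinal.{u}} (hν : Cardinal.aleph0 ≤ ν)
    (hV : Cardinal.mk V ≤ ν) (hνκ : ν ≤ κ) (hK : Cardinal.mk K ≤ κ) (hF : κ < Cardinal.mk F)
    (W : Set F) (hW : Cardinal.mk W ≤ κ) (ev : F → I → V) (ε : K → Set I) (γ : K → I → V)
    (h : ∀ k, ∀ B : Set F, Disjoint B W → Cardinal.mk B ≤ ν → ∀ v : F → V,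
      ∃ i ∈ ε k, ∀ f ∈ B, ev f i = v f) :
    ∃ (f : F) (R : Set F), Cardinal.mk R ≤ κ ∧
      ∀ k, ∀ B : Set F, Disjoint B (W ∪ R) → Cardinal.mk B ≤ ν → ∀ v : F → V,
        ∃ i ∈ ε k, ev f i = γ k i ∧ ∀ f ∈ B, ev f i = v f := by
  classical
  have hκ : Cardinal.aleph0 ≤ κ := hν.trans hνκ
  let Bad (k : K) : Set (F × Set F × (F → V)) :=
    {τ | τ.1 ∉ W ∧ τ.1 ∉ τ.2.1 ∧ Disjoint τ.2.1 W ∧ Cardinal.mk τ.2.1 ≤ ν ∧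
      ∀ i ∈ ε k, ev τ.1 i = γ k i → ∃ f ∈ τ.2.1, ev f i ≠ τ.2.2 f}
  let supp (τ : F × Set F × (F → V)) : Set F := insert τ.1 τ.2.1
  have hsupp (k : K) (τ) (hτ : τ ∈ Bad k) : Cardinal.mk (supp τ) ≤ ν :=
    Cardinal.mk_insert_le.trans
      (Cardinal.add_le_of_le hν hτ.2.2.2.1 (Cardinal.one_le_aleph0.trans hν))
  choose T hTB hTd hTm using fun k => exists_maximal_subset_pairwiseDisjoint (Bad k) supp
  have hTν (k : K) : Cardinal.mk (T k) ≤ ν := by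
    by_contra hcon
    obtain ⟨τ⟩ := Cardinal.le_def _ _ |>.1 (hV.trans (not_le.1 hcon).le)
    have huniq (n m : V) (f : F) (hn : f ∈ supp (τ n)) (hm : f ∈ supp (τ m)) : n = m := by
      by_contra hne
      have hne' : (τ n : F × Set F × (F → V)) ≠ τ m :=
        fun hh => hne (τ.injective (Subtype.ext hh))
      exact Set.disjoint_left.1 (hTd k (τ n).2 (τ m).2 hne') hn hm
    let idx (f : F) : V := Classical.epsilon fun n => f ∈ supp (τ n)
    have hidx (n : V) (f : F) (hf : f ∈ supp (τ n)) : idx f = n :=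
      huniq _ _ f (Classical.epsilon_spec (p := fun n => f ∈ supp (τ n)) ⟨n, hf⟩) hf
    let v (f : F) : V :=
      if f = (τ (idx f)).1.1 then idx f else (τ (idx f)).1.2.2 f
    obtain ⟨i, hi, hiv⟩ := h k (⋃ n, supp (τ n))
      (Set.disjoint_iUnion_left.2 fun n => Set.disjoint_insert_left.2
        ⟨(hTB k (τ n).2).1, (hTB k (τ n).2).2.2.1⟩)
      ((Cardinal.mk_iUnion_le _).trans
        ((mul_le_mul' hV (ciSup_le' fun n => hsupp k _ (hTB k (τ n).2))).trans
          (Cardinal.mul_eq_self hν).le)) v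
    have hval (n : V) (f : F) (hf : f ∈ supp (τ n)) :
        ev f i = if f = (τ n).1.1 then n else (τ n).1.2.2 f := by
      rw [hiv f (Set.mem_iUnion.2 ⟨n, hf⟩)]
      simp only [v, hidx n f hf]
    obtain ⟨-, hnot, -, -, hbad⟩ := hTB k (τ (γ k i)).2
    obtain ⟨f, hfB, hfne⟩ := hbad i hi (by
      rw [hval (γ k i) _ (Set.mem_insert _ _), if_pos rfl])
    refine hfne ?_
    rw [hval (γ k i) f (Set.mem_insert_of_mem _ hfB), if_neg]
    rintro rfl
    exact hnot hfB
  let R₀ : Set F := ⋃ k, ⋃ t : T k, supp t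
  have hR₀ : Cardinal.mk R₀ ≤ κ := by
    refine (Cardinal.mk_iUnion_le _).trans
      ((mul_le_mul' hK (ciSup_le' fun k => ?_)).trans (Cardinal.mul_eq_self hκ).le)
    refine (Cardinal.mk_iUnion_le _).trans
      ((mul_le_mul' ((hTν k).trans hνκ) (ciSup_le' fun t => ?_)).trans
        (Cardinal.mul_eq_self hκ).le)
    exact (hsupp k _ (hTB k t.2)).trans hνκ
  obtain ⟨f, hf⟩ : ∃ f, f ∉ W ∪ R₀ := by
    by_contra! hcon
    have : Cardinal.mk (W ∪ R₀ : Set F) ≤ κ :=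
      (Cardinal.mk_union_le _ _).trans (Cardinal.add_le_of_le hκ hW hR₀)
    rw [Set.eq_univ_of_forall hcon, Cardinal.mk_univ] at this
    exact this.not_gt hF
  simp only [Set.mem_union, not_or] at hf
  refine ⟨f, insert f R₀, Cardinal.mk_insert_le.trans
    (Cardinal.add_le_of_le hκ hR₀ (Cardinal.one_le_aleph0.trans hκ)), fun k B hB hBν v => ?_⟩
  by_contra! hcon
  rw [Set.disjoint_union_right, Set.disjoint_insert_right] at hB
  obtain ⟨t, ht, hdis⟩ := hTm k (f, B, v) ⟨hf.1, hB.2.1, hB.1, hBν, hcon⟩ (Set.insert_nonempty _ _)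
  have hsub : supp t ⊆ R₀ := fun x hx => Set.mem_iUnion.2 ⟨k, Set.mem_iUnion.2 ⟨⟨t, ht⟩, hx⟩⟩
  exact hdis (Set.disjoint_insert_right.2 ⟨fun hmem => hf.2 (hsub hmem), hB.2.2.symm.mono_left hsub⟩)

open FirstOrder in
/-- The set of indices at which the tuples `a` and `b` satisfy the same formulas of `Δ`. -/
def agreeSet (L : FirstOrder.Language.{0, 0}) {M N A I : Type u} [L.Structure M] [L.Structure N]
    (a : A → I → M) (b : A → I → N) (Δ : Finset (L.Formula A)) : Set I :=
  {i | ∀ φ ∈ Δ, φ.Realize (fun t => a t i) ↔ φ.Realize (fun t => b t i)}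

/-- The functions `ev f` with `f ∉ W` are independent modulo the filter generated by the sets
`agreeSet L a b Δ`. -/
def IndepModulo (L : FirstOrder.Language.{0, 0}) {M N A I F V : Type u} [L.Structure M]
    [L.Structure N] (ν : Cardinal.{u}) (ev : F → I → V) (W : Set F)
    (a : A → I → M) (b : A → I → N) : Prop :=
  ∀ Δ : Finset (L.Formula A), ∀ B : Set F, Disjoint B W → Cardinal.mk B ≤ ν → ∀ v : F → V,
    ∃ i ∈ agreeSet L a b Δ, ∀ f ∈ B, ev f i = v f

section KeislerShelah

open FirstOrder

variable {L : FirstOrder.Language.{0, 0}} {M N A A' I F V : Type u} [L.Structure M] [L.Structure N]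
  {ν κ : Cardinal.{u}} {ev : F → I → V} {W W' : Set F} {a : A → I → M} {b : A → I → N}

theorem agreeSet_symm (Δ : Finset (L.Formula A)) : agreeSet L b a Δ = agreeSet L a b Δ := by
  ext i
  exact forall₂_congr fun φ _ => Iff.comm

theorem IndepModulo.symm (h : IndepModulo L ν ev W a b) : IndepModulo L ν ev W b a := by
  intro Δ
  rw [agreeSet_symm]
  exact h Δ

theorem IndepModulo.mono (h : IndepModulo L ν ev W a b) (hW : W ⊆ W') :
    IndepModulo L ν ev W' a b :=
  fun Δ B hB => h Δ B (hB.mono_right hW)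

theorem IndepModulo.comap (h : IndepModulo L ν ev W a b) (g : A' → A) :
    IndepModulo L ν ev W (a ∘ g) (b ∘ g) := by
  classical
  intro Δ B hB hν v
  obtain ⟨i, hi, hiv⟩ := h (Δ.image (Language.Formula.relabel g)) B hB hν v
  refine ⟨i, fun φ hφ => ?_, hiv⟩
  have := hi _ (Finset.mem_image_of_mem _ hφ)
  rw [Language.Formula.realize_relabel, Language.Formula.realize_relabel] at this
  exact this

/-- The formula saying that some element has the pattern `T` over the formulas of `Δ`. -/
noncomputable def patternFormula (Δ T : Finset (L.Formula (A ⊕ Unit))) : L.Formula A :=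
  open Classical in
  (Language.Formula.iInf fun φ : Δ => if φ.1 ∈ T then φ.1 else ∼φ.1).iExs Unit

theorem realize_patternFormula (Δ T : Finset (L.Formula (A ⊕ Unit))) (v : A → M) :
    (patternFormula Δ T).Realize v ↔
      ∃ c : M, ∀ φ ∈ Δ, (φ.Realize (Sum.elim v fun _ => c) ↔ φ ∈ T) := by
  classical
  rw [patternFormula, Language.Formula.realize_iExs]
  refine ⟨fun ⟨w, hw⟩ => ⟨w (), fun φ hφ => ?_⟩, fun ⟨c, hc⟩ => ⟨fun _ => c, ?_⟩⟩
  · have := Language.Formula.realize_iInf.1 hw ⟨φ, hφ⟩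
    change φ.Realize (Sum.elim v w) ↔ _
    by_cases hT : φ ∈ T
    · simpa [hT] using this
    · simpa [hT] using this
  · refine Language.Formula.realize_iInf.2 fun φ => ?_
    have := hc φ.1 φ.2
    by_cases hT : φ.1 ∈ T
    · simpa [hT] using this
    · simpa [hT] using this

theorem IndepModulo.exists_extend [Nonempty V] (h : IndepModulo L ν ev W a b)
    (hν : Cardinal.aleph0 ≤ ν) (hV : Cardinal.mk V ≤ ν) (hνκ : ν ≤ κ)
    (hK : Cardinal.mk (L.Formula (A ⊕ Unit)) ≤ κ) (hF : κ < Cardinal.mk F)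
    (hW : Cardinal.mk W ≤ κ) (x : I → M) {π : V → N} (hπ : Function.Surjective π) :
    ∃ (f : F) (R : Set F), Cardinal.mk R ≤ κ ∧
      IndepModulo L ν ev (W ∪ R) (Sum.elim a fun _ : Unit => x)
        (Sum.elim b fun _ : Unit => π ∘ ev f) := by
  classical
  have hκ := hν.trans hνκ
  let ok (Δ : Finset (L.Formula (A ⊕ Unit))) (i : I) (c : V) : Prop :=
    ∀ φ ∈ Δ, φ.Realize (Sum.elim (fun t => a t i) fun _ => x i) ↔
      φ.Realize (Sum.elim (fun t => b t i) fun _ => π c)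
  have hK' : Cardinal.mk (Finset (L.Formula (A ⊕ Unit))) ≤ κ := by
    rcases finite_or_infinite (L.Formula (A ⊕ Unit)) with hfin | hinf
    · exact (Cardinal.mk_lt_aleph0).le.trans hκ
    · rwa [Cardinal.mk_finset_of_infinite]
  obtain ⟨f, R, hR, hfR⟩ := exists_hitting hν hV hνκ hK' hF W hW ev
    (fun Δ => {i | ∃ c, ok Δ i c}) (fun Δ i => Classical.epsilon (ok Δ i)) (by
      intro Δ B hB hBν v
      obtain ⟨i, hi, hiv⟩ := h (Δ.powerset.image (patternFormula Δ)) B hB hBν v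
      refine ⟨i, ?_, hiv⟩
      let T := Δ.filter fun φ => φ.Realize (Sum.elim (fun t => a t i) fun _ => x i)
      have hT := hi (patternFormula Δ T) (Finset.mem_image_of_mem _
        (Finset.mem_powerset.2 (Finset.filter_subset _ _)))
      rw [realize_patternFormula, realize_patternFormula] at hT
      obtain ⟨c, hc⟩ := hT.1 ⟨x i, fun φ hφ => by simp [T, hφ]⟩
      obtain ⟨d, rfl⟩ := hπ c
      refine ⟨d, fun φ hφ => ?_⟩
      rw [hc φ hφ]
      simp [T, hφ])
  refine ⟨f, R, hR, fun Δ B hB hBν v => ?_⟩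
  obtain ⟨i, hi, hif, hiv⟩ := hfR Δ B hB hBν v
  refine ⟨i, fun φ hφ => ?_, hiv⟩
  have := Classical.epsilon_spec hi φ hφ
  rw [← hif] at this
  convert this using 2 <;> · ext t; cases t <;> rfl

theorem IndepModulo.of_Iic [LinearOrder A] (hMN : L.ElementarilyEquivalent M N)
    (h₀ : ∀ B : Set F, Disjoint B W → Cardinal.mk B ≤ ν → ∀ v : F → V, ∃ i, ∀ f ∈ B, ev f i = v f)
    (h : ∀ t : A, IndepModulo L ν ev W (fun r : Set.Iic t => a r) (fun r : Set.Iic t => b r)) :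
    IndepModulo L ν ev W a b := by
  classical
  intro Δ B hB hBν v
  let vars : Finset A := Δ.biUnion fun φ => Language.BoundedFormula.freeVarFinset φ
  have hsub (φ : L.Formula A) (hφ : φ ∈ Δ) {t : A}
      (ht : t ∈ Language.BoundedFormula.freeVarFinset φ) : t ∈ vars :=
    Finset.mem_biUnion.2 ⟨φ, hφ, ht⟩
  rcases vars.eq_empty_or_nonempty with hempty | hne
  · obtain ⟨i, hiv⟩ := h₀ B hB hBν v
    refine ⟨i, fun φ hφ => ?_, hiv⟩
    have hno (t : Language.BoundedFormula.freeVarFinset φ) : Empty := by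
      have := hsub φ hφ t.2
      simp [hempty] at this
    let σ : L.Sentence := Language.BoundedFormula.restrictFreeVar φ hno
    have hM : σ.Realize M ↔ φ.Realize (fun t => a t i) :=
      Language.BoundedFormula.realize_restrictFreeVar _ (fun t => (hno t).elim)
    have hN : σ.Realize N ↔ φ.Realize (fun t => b t i) :=
      Language.BoundedFormula.realize_restrictFreeVar _ (fun t => (hno t).elim)
    rw [← hM, ← hN]
    exact hMN.realize_sentence σ
  · let t := vars.max' hne
    have hle (φ : L.Formula A) (hφ : φ ∈ Δ) (r : Language.BoundedFormula.freeVarFinset φ) :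
        (r : A) ≤ t := vars.le_max' _ (hsub φ hφ r.2)
    let ψ (φ : Δ) : L.Formula (Set.Iic t) :=
      Language.BoundedFormula.restrictFreeVar φ.1
        (fun r => (⟨r, hle φ.1 φ.2 r⟩ : Set.Iic t))
    obtain ⟨i, hi, hiv⟩ := h t (Finset.univ.image ψ) B hB hBν v
    refine ⟨i, fun φ hφ => ?_, hiv⟩
    have := hi (ψ ⟨φ, hφ⟩) (Finset.mem_image_of_mem _ (Finset.mem_univ _))
    refine Iff.trans (Iff.symm ?_) (this.trans ?_)
    · exact Language.BoundedFormula.realize_restrictFreeVar _ (fun r => rfl)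
    · exact Language.BoundedFormula.realize_restrictFreeVar _ (fun r => rfl)

end KeislerShelah

section Construction

open FirstOrder Cardinal

theorem mk_formula_le (L : FirstOrder.Language.{0, 0}) (hL : L.card ≤ ℵ₀) (A : Type u)
    {κ : Cardinal.{u}} (hκ : ℵ₀ ≤ κ) (hA : #A ≤ κ) : #(L.Formula A) ≤ κ := by
  have h1 : #(L.Formula A) ≤ #(Σ n, L.BoundedFormula A n) :=
    Cardinal.mk_le_of_injective (f := fun φ => ⟨0, φ⟩) fun _ _ h => by simpa using h
  refine h1.trans (Language.BoundedFormula.card_le.trans (max_le hκ ?_))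
  refine Cardinal.add_le_of_le hκ (by simpa using hA) (le_trans ?_ hκ)
  simpa using Cardinal.lift_le.{u}.2 hL

/-- A form of the Keisler–Shelah theorem: elementarily equivalent structures in a countable
language have ultrapowers which satisfy the same formulas under a common enumeration. -/
theorem exists_ultrafilter_realize_iff (L : FirstOrder.Language.{0, 0}) (hL : L.card ≤ ℵ₀)
    (M N : Type u) [L.Structure M] [L.Structure N] [Nonempty M] [Nonempty N]
    (hMN : L.ElementarilyEquivalent M N) :
    ∃ (I S : Type u) (U : Ultrafilter I) (a : S → I → M) (b : S → I → N),
      Function.Surjective a ∧ Function.Surjective b ∧ ∀ φ : L.Formula S,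
        ∀ᶠ i in (U : Filter I), φ.Realize (fun s => a s i) ↔ φ.Realize (fun s => b s i) := by
  classical
  let J := M × N × ℕ
  obtain ⟨ev, hev⟩ := exists_independent_family J
  let ν := #J
  have hν : ℵ₀ ≤ ν := Cardinal.aleph0_le_mk J
  let πM : J → M := fun j => j.1
  let πN : J → N := fun j => j.2.1
  have hπM : Function.Surjective πM := fun m => ⟨(m, Classical.arbitrary N, 0), rfl⟩
  have hπN : Function.Surjective πN := fun n => ⟨(Classical.arbitrary M, n, 0), rfl⟩
  let I := (J × J → Set J) × (J → Set (J × J)) × (J → J)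
  let F := Set (Set J)
  let θ := #F
  have hθ : θ = (2 : Cardinal.{u}) ^ ((2 : Cardinal.{u}) ^ ν) := by simp [θ, F, ν]
  have hI : #I ≤ 2 ^ ν := by
    have h2 : ℵ₀ ≤ 2 ^ ν := hν.trans (cantor ν).le
    have hJJ : #J * #J = ν := mul_eq_self hν
    simp only [I, mk_prod, Cardinal.lift_id, ← Cardinal.power_def, mk_set]
    change (2 ^ ν) ^ (#J * #J) * ((2 ^ (#J * #J)) ^ ν * ν ^ ν) ≤ _
    rw [hJJ, ← power_mul, mul_eq_self hν, power_self_eq hν, mul_eq_self h2, mul_eq_self h2]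
  have hfun (Z : Type u) (hZ : #Z ≤ ν) : #(I → Z) ≤ θ := by
    rw [hθ, ← Cardinal.power_def]
    have h2 : ℵ₀ ≤ 2 ^ ν := hν.trans (cantor ν).le
    rw [← power_self_eq h2]
    exact (power_le_power_right (hZ.trans (cantor ν).le)).trans
      (power_le_power_left (aleph0_pos.trans_le h2).ne' hI)
  have hθ0 : ℵ₀ ≤ θ := by
    rw [hθ]
    exact hν.trans ((cantor ν).le.trans (cantor _).le)
  let S := θ.ord.ToType
  have hS : #S = θ := mk_ord_toType θ
  obtain ⟨task, htask⟩ : ∃ task : S → (I → M) ⊕ (I → N), Function.Surjective task := by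
    have hle : #((I → M) ⊕ (I → N)) ≤ #S := by
      rw [hS, mk_sum, Cardinal.lift_id, Cardinal.lift_id]
      exact add_le_of_le hθ0 (hfun M (mk_le_of_surjective hπM))
        (hfun N (mk_le_of_surjective hπN))
    obtain ⟨e⟩ := Cardinal.le_def _ _ |>.1 hle
    exact ⟨Function.invFun e, Function.invFun_surjective e.injective⟩
  let T := (I → M) × (I → N) × Set F
  let κ (s : S) := max ν #(Set.Iio s)
  let Q (s : S) (g : S → T) : Prop :=
    Sum.elim (fun x => (g s).1 = x) (fun y => (g s).2.1 = y) (task s) ∧ #(g s).2.2 ≤ κ s ∧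
      IndepModulo L ν ev (⋃ t : Set.Iic s, (g t).2.2)
        (fun r : Set.Iic s => (g r).1) (fun r : Set.Iic s => (g r).2.1)
  have hκθ (s : S) : κ s < θ :=
    max_lt (hθ ▸ (cantor ν).trans (cantor _)) ((mk_Iio_lt s (by rw [hS, Ordinal.type_toType])).trans_eq hS)
  have hκmono {s t : S} (h : s ≤ t) : κ s ≤ κ t :=
    max_le_max le_rfl (mk_le_mk_of_subset (Set.Iio_subset_Iio h))
  have hupd (s : S) (g : S → T) (x : I → M) (y : I → N) (R : Set F)
      (h : IndepModulo L ν ev ((⋃ t : Set.Iio s, (g t).2.2) ∪ R)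
        (Sum.elim (fun r : Set.Iio s => (g r).1) fun _ : Unit => x)
        (Sum.elim (fun r : Set.Iio s => (g r).2.1) fun _ : Unit => y)) :
      IndepModulo L ν ev (⋃ t : Set.Iic s, (Function.update g s (x, y, R) t).2.2)
        (fun r : Set.Iic s => (Function.update g s (x, y, R) r).1)
        (fun r : Set.Iic s => (Function.update g s (x, y, R) r).2.1) := by
    have := (h.comap (fun r : Set.Iic s =>
      if hr : (r : S) < s then Sum.inl (⟨r, hr⟩ : Set.Iio s) else Sum.inr ())).mono
      (W' := ⋃ t : Set.Iic s, (Function.update g s (x, y, R) t).2.2) (by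
        refine Set.union_subset (Set.iUnion_subset fun t => ?_) ?_
        · refine le_trans ?_ (Set.subset_iUnion _ (⟨t, (Set.mem_Iio.1 t.2).le⟩ : Set.Iic s))
          simp [Function.update_of_ne (Set.mem_Iio.1 t.2).ne]
        · refine le_trans ?_ (Set.subset_iUnion _ (⟨s, Set.mem_Iic.2 le_rfl⟩ : Set.Iic s))
          simp)
    convert this using 1
    · funext r
      rcases r with ⟨r, hr⟩
      rcases lt_or_eq_of_le (Set.mem_Iic.1 hr) with h | rfl
      · simp [h, h.ne]
      · simp
    · funext r
      rcases r with ⟨r, hr⟩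
      rcases lt_or_eq_of_le (Set.mem_Iic.1 hr) with h | rfl
      · simp [h, h.ne]
      · simp
  obtain ⟨g, hg⟩ := exists_forall_of_wellFounded_step Q (by
    rintro s g g' hgg ⟨h1, h2, h3⟩
    have hs := hgg s le_rfl
    have h' (r : Set.Iic s) : g r = g' r := hgg r r.2
    refine ⟨by rwa [← hs], by rwa [← hs], ?_⟩
    simpa only [h'] using h3) (by
    intro s g ih
    have hκ : ℵ₀ ≤ κ s := hν.trans (le_max_left _ _)
    have hind : IndepModulo L ν ev (⋃ t : Set.Iio s, (g t).2.2)
        (fun r : Set.Iio s => (g r).1) (fun r : Set.Iio s => (g r).2.1) := by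
      refine IndepModulo.of_Iic hMN (fun B _ hB v => hev B hB v) fun t => ?_
      refine ((ih t (Set.mem_Iio.1 t.2)).2.2.comap
        (fun r : Set.Iic t => (⟨r.1, r.2⟩ : Set.Iic (t : S)))).mono ?_
      exact Set.iUnion_subset fun r =>
        Set.subset_iUnion (fun t : Set.Iio s => (g t).2.2) 
          ⟨r, Set.mem_Iio.2 (lt_of_le_of_lt (Set.mem_Iic.1 r.2) (Set.mem_Iio.1 t.2))⟩
    have hW : #(⋃ t : Set.Iio s, (g t).2.2 : Set F) ≤ κ s :=
      (mk_iUnion_le _).trans ((mul_le_mul' (le_max_right _ _) (ciSup_le' fun t : Set.Iio s =>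
        (ih t (Set.mem_Iio.1 t.2)).2.1.trans (hκmono (Set.mem_Iio.1 t.2).le))).trans (mul_eq_self hκ).le)
    have hK : #(L.Formula (Set.Iio s ⊕ Unit)) ≤ κ s := by
      refine mk_formula_le L hL _ hκ ?_
      simpa using add_le_of_le hκ (le_max_right _ _) (one_le_aleph0.trans hκ)
    rcases htk : task s with x | y
    · obtain ⟨f, R, hR, h⟩ := hind.exists_extend hν le_rfl (le_max_left _ _) hK (hκθ s) hW x hπN
      exact ⟨(x, πN ∘ ev f, R), by simp [htk], by rwa [Function.update_self], hupd s g _ _ _ h⟩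
    · obtain ⟨f, R, hR, h⟩ :=
        hind.symm.exists_extend hν le_rfl (le_max_left _ _) hK (hκθ s) hW y hπM
      exact ⟨(πM ∘ ev f, y, R), by simp [htk], by rwa [Function.update_self], hupd s g _ _ _ h.symm⟩)
  let a (s : S) := (g s).1
  let b (s : S) := (g s).2.1
  have hind : IndepModulo L ν ev (⋃ t, (g t).2.2) a b := by
    refine IndepModulo.of_Iic hMN (fun B _ hB v => hev B hB v) fun t => (hg t).2.2.mono ?_
    exact Set.iUnion_subset fun r => Set.subset_iUnion (fun t => (g t).2.2) (r : S)
  let 𝓕 : Filter I := ⨅ Δ : Finset (L.Formula S), Filter.principal (agreeSet L a b Δ)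
  have h𝓕 : 𝓕.NeBot := by
    refine Filter.iInf_neBot_of_directed' (fun Δ Δ' => ⟨Δ ∪ Δ', ?_, ?_⟩) fun Δ => ?_
    · exact Filter.principal_mono.2 fun i hi φ hφ => hi φ (Finset.mem_union_left _ hφ)
    · exact Filter.principal_mono.2 fun i hi φ hφ => hi φ (Finset.mem_union_right _ hφ)
    · obtain ⟨i, hi, -⟩ := hind Δ ∅ (Set.empty_disjoint _) (by simp) fun _ =>
        Classical.arbitrary J
      exact Filter.principal_neBot_iff.2 ⟨i, hi⟩
  refine ⟨I, S, Ultrafilter.of 𝓕, a, b, fun x => ?_, fun y => ?_, fun φ => ?_⟩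
  · obtain ⟨s, hs⟩ := htask (Sum.inl x)
    have := (hg s).1
    rw [hs] at this
    exact ⟨s, this⟩
  · obtain ⟨s, hs⟩ := htask (Sum.inr y)
    have := (hg s).1
    rw [hs] at this
    exact ⟨s, this⟩
  · refine Ultrafilter.of_le 𝓕 (Filter.mem_of_superset
      (Filter.mem_iInf_of_mem {φ} (Filter.mem_principal_self _)) fun i hi => ?_)
    exact hi φ (Finset.mem_singleton_self φ)

end Construction

section UltrapowerNorm

variable {I X : Type u} {D : Ultrafilter I} [NormedAddCommGroup X] [NormedSpace ℝ X]

/-- Families which are bounded along an ultrafilter. -/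
def BddAlong (D : Ultrafilter I) (z : I → X) : Prop :=
  ∃ c : ℝ, ∀ᶠ i in (D : Filter I), ‖z i‖ ≤ c

theorem exists_lp_of_eventually_le {z : I → X} {c : ℝ} (hc : 0 ≤ c)
    (h : ∀ᶠ i in (D : Filter I), ‖z i‖ ≤ c) :
    ∃ f : lp (fun _ : I => X) ∞, ‖f‖ ≤ c ∧ ∀ᶠ i in (D : Filter I), f i = z i := by
  classical
  have hb (i : I) : ‖if ‖z i‖ ≤ c then z i else 0‖ ≤ c := by
    split_ifs with hi
    · exact hi
    · simpa using hc
  refine ⟨⟨fun i => if ‖z i‖ ≤ c then z i else 0,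
    memℓp_infty ⟨c, by rintro r ⟨i, rfl⟩; exact hb i⟩⟩, ?_, ?_⟩
  · exact lp.norm_le_of_forall_le hc hb
  · filter_upwards [h] with i hi
    exact if_pos hi

theorem mk_eq_mk_of_eventuallyEq {f g : lp (fun _ : I => X) ∞}
    (h : ∀ᶠ i in (D : Filter I), f i = g i) :
    (Submodule.Quotient.mk f : Ultrapower I D X) = Submodule.Quotient.mk g := by
  refine (Submodule.Quotient.eq _).2 ?_
  refine tendsto_const_nhds.congr' ?_
  filter_upwards [h] with i hi
  simp [hi]

/-- The element of the ultrapower represented by a family which is bounded along `D`. -/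
def ultraOf (D : Ultrafilter I) (z : I → X) : Ultrapower I D X :=
  open Classical in
  if h : ∃ f : lp (fun _ : I => X) ∞, ∀ᶠ i in (D : Filter I), f i = z i then
    Submodule.Quotient.mk h.choose else 0

theorem ultraOf_eq_mk {z : I → X} {f : lp (fun _ : I => X) ∞}
    (h : ∀ᶠ i in (D : Filter I), f i = z i) : ultraOf D z = Submodule.Quotient.mk f := by
  have hex : ∃ f : lp (fun _ : I => X) ∞, ∀ᶠ i in (D : Filter I), f i = z i := ⟨f, h⟩
  rw [ultraOf, dif_pos hex]
  refine mk_eq_mk_of_eventuallyEq ?_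
  filter_upwards [hex.choose_spec, h] with i h1 h2
  rw [h1, h2]

theorem BddAlong.exists_lp {z : I → X} (h : BddAlong D z) :
    ∃ f : lp (fun _ : I => X) ∞, ∀ᶠ i in (D : Filter I), f i = z i := by
  obtain ⟨c, hc⟩ := h
  obtain ⟨i, hi⟩ := hc.exists
  obtain ⟨f, -, hf⟩ := exists_lp_of_eventually_le ((norm_nonneg _).trans hi) hc
  exact ⟨f, hf⟩

theorem bddAlong_lp (f : lp (fun _ : I => X) ∞) : BddAlong D f :=
  ⟨‖f‖, Filter.Eventually.of_forall fun i => lp.norm_apply_le_norm (by simp) f i⟩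

theorem exists_bddAlong_ultraOf_eq (u : Ultrapower I D X) :
    ∃ z : I → X, BddAlong D z ∧ ultraOf D z = u := by
  obtain ⟨f, rfl⟩ := Submodule.Quotient.mk_surjective _ u
  exact ⟨f, bddAlong_lp f, ultraOf_eq_mk (Filter.Eventually.of_forall fun _ => rfl)⟩

theorem ultraOf_of_not_bddAlong {z : I → X} (h : ¬ BddAlong D z) : ultraOf D z = 0 := by
  rw [ultraOf, dif_neg]
  rintro ⟨f, hf⟩
  obtain ⟨c, hc⟩ := bddAlong_lp (D := D) f
  refine h ⟨c, ?_⟩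
  filter_upwards [hf, hc] with i h1 h2
  rwa [← h1]

theorem ultraOf_congr {z w : I → X} (h : ∀ᶠ i in (D : Filter I), z i = w i) :
    ultraOf D z = ultraOf D w := by
  by_cases hz : BddAlong D z
  · obtain ⟨f, hf⟩ := hz.exists_lp
    rw [ultraOf_eq_mk hf, ultraOf_eq_mk (f := f)]
    filter_upwards [h, hf] with i h1 h2
    rw [h2, h1]
  · have hw : ¬ BddAlong D w := by
      rintro ⟨c, hc⟩
      refine hz ⟨c, ?_⟩
      filter_upwards [h, hc] with i h1 h2
      rwa [h1]
    rw [ultraOf_of_not_bddAlong hz, ultraOf_of_not_bddAlong hw]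

theorem BddAlong.smul_add_smul {z w : I → X} (hz : BddAlong D z) (hw : BddAlong D w) (p q : ℝ) :
    BddAlong D fun i => p • z i + q • w i := by
  obtain ⟨c, hc⟩ := hz
  obtain ⟨d, hd⟩ := hw
  refine ⟨‖p‖ * c + ‖q‖ * d, ?_⟩
  filter_upwards [hc, hd] with i h1 h2
  refine (norm_add_le _ _).trans ?_
  rw [norm_smul, norm_smul]
  gcongr

theorem ultraOf_smul_add_smul {z w : I → X} (hz : BddAlong D z) (hw : BddAlong D w) (p q : ℝ) :
    ultraOf D (fun i => p • z i + q • w i) = p • ultraOf D z + q • ultraOf D w := by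
  obtain ⟨f, hf⟩ := hz.exists_lp
  obtain ⟨g, hg⟩ := hw.exists_lp
  rw [ultraOf_eq_mk hf, ultraOf_eq_mk hg, ultraOf_eq_mk (f := p • f + q • g)]
  · rfl
  · filter_upwards [hf, hg] with i h1 h2
    rw [← h1, ← h2]
    rfl

theorem norm_ultraOf_le {z : I → X} {c : ℝ} (h : ∀ᶠ i in (D : Filter I), ‖z i‖ ≤ c) :
    ‖ultraOf D z‖ ≤ c := by
  obtain ⟨i, hi⟩ := h.exists
  obtain ⟨f, hfc, hf⟩ := exists_lp_of_eventually_le ((norm_nonneg _).trans hi) h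
  rw [ultraOf_eq_mk hf]
  exact (Submodule.Quotient.norm_mk_le _ _).trans hfc

theorem eventually_norm_lt_of_norm_ultraOf_lt {z : I → X} (hz : BddAlong D z) {c : ℝ}
    (h : ‖ultraOf D z‖ < c) : ∀ᶠ i in (D : Filter I), ‖z i‖ < c := by
  obtain ⟨f, hf⟩ := hz.exists_lp
  rw [ultraOf_eq_mk hf] at h
  obtain ⟨g, hg, hgc⟩ := Submodule.Quotient.norm_mk_lt
    (Submodule.Quotient.mk f : Ultrapower I D X) (sub_pos.2 h)
  rw [add_sub_cancel] at hgc
  have hfg : Filter.Tendsto (fun i => ‖(f - g : lp (fun _ : I => X) ∞) i‖)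
    (D : Filter I) (nhds 0) := (Submodule.Quotient.eq _).1 hg.symm
  filter_upwards [hf, hfg.eventually_lt_const (sub_pos.2 hgc)] with i h1 h2
  rw [← h1]
  have h3 : ‖g i‖ ≤ ‖g‖ := lp.norm_apply_le_norm (by simp) g i
  have h4 : ‖f i‖ ≤ ‖g i‖ + ‖f i - g i‖ := by
    simpa using norm_add_le (g i) (f i - g i)
  simp only [lp.coeFn_sub, Pi.sub_apply] at h2
  linarith

theorem dist_ultraOf {z w : I → X} (hz : BddAlong D z) (hw : BddAlong D w) :
    dist (ultraOf D z) (ultraOf D w) = ‖ultraOf D (fun i => z i - w i)‖ := by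
  have := ultraOf_smul_add_smul hz hw 1 (-1)
  simp only [one_smul, neg_smul, ← sub_eq_add_neg] at this
  rw [this, dist_eq_norm]

theorem BddAlong.sub {z w : I → X} (hz : BddAlong D z) (hw : BddAlong D w) :
    BddAlong D fun i => z i - w i := by
  have := hz.smul_add_smul hw 1 (-1)
  simpa only [one_smul, neg_smul, ← sub_eq_add_neg] using this

theorem dist_ultraOf_le {z w : I → X} (hz : BddAlong D z) (hw : BddAlong D w) {c : ℝ}
    (h : ∀ᶠ i in (D : Filter I), dist (z i) (w i) ≤ c) : dist (ultraOf D z) (ultraOf D w) ≤ c := by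
  rw [dist_ultraOf hz hw]
  simp only [dist_eq_norm] at h
  exact norm_ultraOf_le h

theorem eventually_dist_lt_of_dist_ultraOf_lt {z w : I → X} (hz : BddAlong D z)
    (hw : BddAlong D w) {c : ℝ} (h : dist (ultraOf D z) (ultraOf D w) < c) :
    ∀ᶠ i in (D : Filter I), dist (z i) (w i) < c := by
  rw [dist_ultraOf hz hw] at h
  simpa only [dist_eq_norm] using eventually_norm_lt_of_norm_ultraOf_lt (hz.sub hw) h

instance isClosed_ultraNullIdeal (I : Type u) (D : Ultrafilter I) (X : Type u)
    [NormedAddCommGroup X] [NormedSpace ℝ X] :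
    IsClosed (ultraNullIdeal I D X : Set (lp (fun _ : I => X) ∞)) := by
  refine isClosed_of_closure_subset fun f hf => ?_
  change Filter.Tendsto (fun i => ‖f i‖) (D : Filter I) (nhds 0)
  refine tendsto_order.2 ⟨fun a ha => Filter.Eventually.of_forall fun i =>
    ha.trans_le (norm_nonneg _), fun ε hε => ?_⟩
  obtain ⟨g, hg, hfg⟩ := Metric.mem_closure_iff.1 hf (ε / 2) (half_pos hε)
  have hg' : Filter.Tendsto (fun i => ‖g i‖) (D : Filter I) (nhds 0) := hg
  filter_upwards [hg'.eventually_lt_const (half_pos hε)] with i hi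
  have h1 : ‖f i - g i‖ ≤ ‖f - g‖ := lp.norm_apply_le_norm (by simp) (f - g) i
  rw [dist_eq_norm] at hfg
  have h4 : ‖f i‖ ≤ ‖g i‖ + ‖f i - g i‖ := by
    simpa using norm_add_le (g i) (f i - g i)
  linarith

instance completeSpace_ultrapower (I : Type u) (D : Ultrafilter I) (X : Type u)
    [NormedAddCommGroup X] [NormedSpace ℝ X] [CompleteSpace X] :
    CompleteSpace (Ultrapower I D X) :=
  Submodule.Quotient.completeSpace _

end UltrapowerNorm

section Dimension

open Cardinal

theorem span_subset_closure_of_rat_combinations {Y : Type*} [NormedAddCommGroup Y]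
    [NormedSpace ℝ Y] {S : Set Y} (h0 : S.Nonempty)
    (h : ∀ p q : ℚ, ∀ x ∈ S, ∀ y ∈ S, (p : ℝ) • x + (q : ℝ) • y ∈ S) :
    (Submodule.span ℝ S : Set Y) ⊆ closure S := by
  have hcomb (p q : ℝ) {x y : Y} (hx : x ∈ closure S) (hy : y ∈ closure S) :
      p • x + q • y ∈ closure S := by
    have hdense : DenseRange ((↑) : ℚ → ℝ) := Rat.denseRange_cast
    have hr (p q : ℚ) {x y : Y} (hx : x ∈ closure S) (hy : y ∈ closure S) :
        (p : ℝ) • x + (q : ℝ) • y ∈ closure S :=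
      map_mem_closure₂ (f := fun x y : Y => (p : ℝ) • x + (q : ℝ) • y)
        (by unfold Function.uncurry; fun_prop) hx hy (h p q)
    have := map_mem_closure₂ (f := fun p q : ℝ => p • x + q • y) (s := Set.range ((↑) : ℚ → ℝ))
      (t := Set.range ((↑) : ℚ → ℝ)) (u := closure S)
      (by unfold Function.uncurry; fun_prop) (hdense p) (hdense q) (by
        rintro _ ⟨p, rfl⟩ _ ⟨q, rfl⟩
        exact hr p q hx hy)
    rwa [closure_closure] at this
  intro x hx
  induction hx using Submodule.span_induction with
  | mem x hx => exact subset_closure hx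
  | zero =>
    obtain ⟨x, hx⟩ := h0
    simpa using hcomb 0 0 (subset_closure hx) (subset_closure hx)
  | add x y _ _ hx hy => simpa using hcomb 1 1 hx hy
  | smul a x _ hx => simpa using hcomb a 0 hx hx

theorem mk_le_of_separated {Y J : Type u} [PseudoMetricSpace Y] (d : J → Y)
    (hd : Pairwise fun i j => 1 ≤ dist (d i) (d j)) (C : Set Y)
    (hC : ∀ j, ∃ c ∈ C, dist (d j) c < 1 / 2) : #J ≤ #C := by
  choose c hcC hc using hC
  refine mk_le_of_injective (f := fun j => (⟨c j, hcC j⟩ : C)) fun i j hij => ?_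
  by_contra hne
  have h1 := hd hne
  have h2 : c i = c j := congrArg Subtype.val hij
  have h3 := hc i
  have h4 := hc j
  rw [← h2] at h4
  have := dist_triangle_right (d i) (d j) (c i)
  linarith

theorem mk_le_bdim_of_separated {Y J : Type u} [NormedAddCommGroup Y] [NormedSpace ℝ Y]
    [Infinite J] (d : J → Y) (hd : Pairwise fun i j => 1 ≤ dist (d i) (d j)) {R : ℝ}
    (hR : ∀ j, ‖d j‖ ≤ R) : #J ≤ bdim Y := by
  refine le_csInf ⟨#(Set.univ : Set Y), Set.univ, rfl, ?_⟩ ?_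
  · rw [Submodule.span_univ]
    exact eq_top_iff.2 (Submodule.le_topologicalClosure _)
  rintro _ ⟨A, rfl, hA⟩
  rcases A.finite_or_infinite with hfin | hinf
  · exfalso
    have : FiniteDimensional ℝ (Submodule.span ℝ A) := FiniteDimensional.span_of_finite ℝ hfin
    have hclosed : IsClosed (Submodule.span ℝ A : Set Y) := Submodule.closed_of_finiteDimensional _
    rw [hclosed.submodule_topologicalClosure_eq] at hA
    have : FiniteDimensional ℝ Y := by
      refine Module.Finite.of_surjective (Submodule.span ℝ A).subtype fun y => ?_
      exact ⟨⟨y, hA ▸ Submodule.mem_top⟩, rfl⟩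
    have := FiniteDimensional.proper_real Y
    obtain ⟨t, ht, hsub⟩ := Metric.totallyBounded_iff.1
      (isCompact_closedBall (0 : Y) R).totallyBounded (1 / 2) (by norm_num)
    have hle := mk_le_of_separated d hd t fun j => by
      have := hsub (mem_closedBall_zero_iff.2 (hR j))
      simpa using this
    exact (hle.trans_lt (lt_aleph0_iff_set_finite.2 ht)).not_ge (aleph0_le_mk J)
  · have : Infinite A := hinf.to_subtype
    let σ : (A →₀ ℚ) → Y := fun l => l.sum fun a r => (r : ℝ) • (a : Y)
    have hσ (p q : ℚ) (l m : A →₀ ℚ) :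
        (p : ℝ) • σ l + (q : ℝ) • σ m = σ (p • l + q • m) := by
      simp only [σ]
      rw [Finsupp.sum_add_index' (by simp) (by intros; rw [Rat.cast_add, add_smul]),
        Finsupp.sum_smul_index (by simp), Finsupp.sum_smul_index (by simp),
        Finsupp.smul_sum, Finsupp.smul_sum]
      simp [mul_smul]
    have hAσ : A ⊆ Set.range σ := fun a ha =>
      ⟨Finsupp.single ⟨a, ha⟩ 1, by simp [σ]⟩
    have hcl : (Submodule.span ℝ (Set.range σ) : Set Y) ⊆ closure (Set.range σ) := by
      refine span_subset_closure_of_rat_combinations (Set.range_nonempty _) ?_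
      rintro p q _ ⟨l, rfl⟩ _ ⟨m, rfl⟩
      exact ⟨_, (hσ p q l m).symm⟩
    have hdense (y : Y) : y ∈ closure (Set.range σ) := by
      have hy : y ∈ closure (Submodule.span ℝ A : Set Y) := by
        rw [← Submodule.topologicalClosure_coe, hA]
        trivial
      have := closure_mono
        (Set.Subset.trans (SetLike.coe_subset_coe.2 (Submodule.span_mono (R := ℝ) hAσ)) hcl) hy
      rwa [closure_closure] at this
    calc #J ≤ #(Set.range σ) := mk_le_of_separated d hd _ fun j =>
          Metric.mem_closure_iff.1 (hdense (d j)) (1 / 2) (by norm_num)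
      _ ≤ #(A →₀ ℚ) := mk_range_le
      _ = #A := by
        rw [mk_finsupp_lift_of_infinite]
        simp

end Dimension

section NormLanguage

open FirstOrder Language Structure Cardinal

/-- Function symbols of the language of normed spaces: rational linear combinations. -/
inductive NormFn : ℕ → Type
  | comb (p q : ℚ) : NormFn 2

/-- Relation symbols of the language of normed spaces: rational bounds on norms and distances. -/
inductive NormRel : ℕ → Type
  | normLE (q : ℚ) : NormRel 1
  | distLE (q : ℚ) : NormRel 2

/-- A countable first-order language for real normed spaces. -/
def normLang : FirstOrder.Language.{0, 0} := ⟨NormFn, NormRel⟩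

theorem card_normLang_le : normLang.card ≤ ℵ₀ := by
  have hF : Function.Injective fun x : Σ n, NormFn n =>
      (match x with | ⟨_, .comb p q⟩ => (p, q) : ℚ × ℚ) := by
    rintro ⟨_, ⟨p, q⟩⟩ ⟨_, ⟨p', q'⟩⟩ h
    simp only [Prod.mk.injEq] at h
    obtain ⟨rfl, rfl⟩ := h
    rfl
  have hR : Function.Injective fun x : Σ n, NormRel n =>
      (match x with | ⟨_, .normLE q⟩ => Sum.inl q | ⟨_, .distLE q⟩ => Sum.inr q : ℚ ⊕ ℚ) := by
    rintro ⟨_, ⟨q⟩ | ⟨q⟩⟩ ⟨_, ⟨q'⟩ | ⟨q'⟩⟩ h <;> simp at h <;> subst h <;> rfl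
  have hF' : Countable (Σ n, normLang.Functions n) := hF.countable
  have hR' : Countable (Σ n, normLang.Relations n) := hR.countable
  exact Cardinal.mk_le_aleph0_iff.2 (inferInstanceAs (Countable (_ ⊕ _)))

instance normLangStructure (X : Type*) [NormedAddCommGroup X] [NormedSpace ℝ X] :
    normLang.Structure X where
  funMap := fun f x => match f with | .comb p q => (p : ℝ) • x 0 + (q : ℝ) • x 1
  RelMap := fun r x => match r with
    | .normLE q => ‖x 0‖ ≤ q
    | .distLE q => dist (x 0) (x 1) ≤ q

/-- The interpretation of the symbol bounding the norm. -/
def NormLE {N : Type*} [normLang.Structure N] (q : ℚ) (n : N) : Prop :=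
  RelMap (L := normLang) (NormRel.normLE q : normLang.Relations 1) ![n]

/-- The interpretation of the symbol bounding the distance. -/
def DistLE {N : Type*} [normLang.Structure N] (q : ℚ) (n m : N) : Prop :=
  RelMap (L := normLang) (NormRel.distLE q : normLang.Relations 2) ![n, m]

/-- The interpretation of the symbol for a rational linear combination. -/
def ratComb {N : Type*} [normLang.Structure N] (p q : ℚ) (n m : N) : N :=
  funMap (L := normLang) (NormFn.comb p q : normLang.Functions 2) ![n, m]

theorem normLE_iff_norm_le {X : Type*} [NormedAddCommGroup X] [NormedSpace ℝ X] (q : ℚ) (x : X) :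
    NormLE q x ↔ ‖x‖ ≤ q := Iff.rfl

theorem distLE_iff_dist_le {X : Type*} [NormedAddCommGroup X] [NormedSpace ℝ X] (q : ℚ)
    (x y : X) : DistLE q x y ↔ dist x y ≤ q := Iff.rfl

theorem realize_normLE_iff {N S : Type*} [normLang.Structure N] (q : ℚ) (s : S) (v : S → N) :
    (Relations.formula₁ (L := normLang) (NormRel.normLE q) (Term.var s)).Realize v ↔
      NormLE q (v s) := Formula.realize_rel₁

theorem realize_distLE_iff {N S : Type*} [normLang.Structure N] (q : ℚ) (s t : S) (v : S → N) :
    (Relations.formula₂ (L := normLang) (NormRel.distLE q) (Term.var s) (Term.var t)).Realize v ↔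
      DistLE q (v s) (v t) := Formula.realize_rel₂

section Embedding

variable {M N : Type*} [normLang.Structure M] [normLang.Structure N]

theorem normLE_map_iff (g : M ↪ₑ[normLang] N) (q : ℚ) (n : M) : NormLE q (g n) ↔ NormLE q n := by
  have := g.map_rel (NormRel.normLE q : normLang.Relations 1) ![n]
  rwa [show g ∘ ![n] = ![g n] from funext fun k => by fin_cases k; rfl] at this

theorem distLE_map_iff (g : M ↪ₑ[normLang] N) (q : ℚ) (n m : M) :
    DistLE q (g n) (g m) ↔ DistLE q n m := by
  have := g.map_rel (NormRel.distLE q : normLang.Relations 2) ![n, m]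
  rwa [show g ∘ ![n, m] = ![g n, g m] from funext fun k => by fin_cases k <;> rfl] at this

theorem map_ratComb (g : M ↪ₑ[normLang] N) (p q : ℚ) (n m : M) :
    g (ratComb p q n m) = ratComb p q (g n) (g m) := by
  have := g.map_fun (NormFn.comb p q : normLang.Functions 2) ![n, m]
  rwa [show g ∘ ![n, m] = ![g n, g m] from funext fun k => by fin_cases k <;> rfl] at this

end Embedding

section Product

variable {K X : Type u} {U : Ultrafilter K} [NormedAddCommGroup X] [NormedSpace ℝ X]

theorem normLE_product_iff (q : ℚ) (z : K → X) :
    NormLE q (z : (U : Filter K).Product fun _ => X) ↔ ∀ᶠ i in (U : Filter K), ‖z i‖ ≤ q := by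
  have := Ultraproduct.realize_formula_cast (L := normLang) (u := U) (M := fun _ => X)
    (Relations.formula₁ (L := normLang) (NormRel.normLE q) (Term.var ())) (fun _ => z)
  simp only [realize_normLE_iff] at this
  exact this

theorem distLE_product_iff (q : ℚ) (z w : K → X) :
    DistLE q (z : (U : Filter K).Product fun _ => X) (w : (U : Filter K).Product fun _ => X) ↔
      ∀ᶠ i in (U : Filter K), dist (z i) (w i) ≤ q := by
  have := Ultraproduct.realize_formula_cast (L := normLang) (u := U) (M := fun _ => X)
    (Relations.formula₂ (L := normLang) (NormRel.distLE q) (Term.var true) (Term.var false))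
    (fun b => if b then z else w)
  simp only [realize_distLE_iff] at this
  exact this

theorem ratComb_product (p q : ℚ) (z w : K → X) :
    ratComb p q (z : (U : Filter K).Product fun _ => X) (w : (U : Filter K).Product fun _ => X) =
      ((fun i => (p : ℝ) • z i + (q : ℝ) • w i : K → X) : (U : Filter K).Product fun _ => X) := by
  have := Ultraproduct.funMap_cast (L := normLang) (u := U) (M := fun _ => X)
    (NormFn.comb p q : normLang.Functions 2) ![z, w]
  refine Eq.trans ?_ this
  refine congrArg (funMap (L := normLang) (NormFn.comb p q : normLang.Functions 2))
    (funext fun k => ?_)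
  fin_cases k <;> rfl

end Product

end NormLanguage

section Transfer

open FirstOrder Language Cardinal

/-- A map from a model of the first-order language of normed spaces to a normed space which is
compatible with the symbols and whose restriction to the finite elements has dense range. -/
structure IsNormModel {N Y : Type*} [normLang.Structure N] [NormedAddCommGroup Y]
    (j : N → Y) : Prop where
  norm_le : ∀ {q : ℚ} {n : N}, NormLE q n → ‖j n‖ ≤ q
  le_norm : ∀ {q r : ℚ} {n : N}, NormLE r n → ¬ NormLE q n → (q : ℝ) ≤ ‖j n‖
  dist_le : ∀ {q r t : ℚ} {n m : N}, NormLE r n → NormLE t m → DistLE q n m →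
    dist (j n) (j m) ≤ q
  le_dist : ∀ {q r t : ℚ} {n m : N}, NormLE r n → NormLE t m → ¬ DistLE q n m →
    (q : ℝ) ≤ dist (j n) (j m)
  dense : ∀ (y : Y) (ε : ℝ), 0 < ε → ∃ (n : N) (r : ℚ), NormLE r n ∧ dist (j n) y < ε

theorem nonempty_linearIsometryEquiv_of_dense {E F : Type*} [NormedAddCommGroup E]
    [NormedSpace ℝ E] [CompleteSpace E] [NormedAddCommGroup F] [NormedSpace ℝ F] (T : E → F)
    (hT : Isometry T) (h0 : T 0 = 0) (hd : DenseRange T) : Nonempty (E ≃ₗᵢ[ℝ] F) := by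
  have hs : Function.Surjective T := by
    have := hT.isClosedEmbedding.isClosed_range.closure_eq
    rw [hd.closure_range] at this
    exact Set.range_eq_univ.1 this.symm
  let e : E ≃ᵢ F := ⟨Equiv.ofBijective T ⟨hT.injective, hs⟩, hT⟩
  exact ⟨e.toRealLinearIsometryEquivOfMapZero h0⟩

theorem elemEquiv_of_isNormModel {X N Y : Type u} [NormedAddCommGroup X] [NormedSpace ℝ X]
    [CompleteSpace X] [NormedAddCommGroup Y] [NormedSpace ℝ Y] [normLang.Structure N]
    [Nonempty N] (hXN : normLang.ElementarilyEquivalent X N) {j : N → Y} (hj : IsNormModel j) :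
    ElemEquiv X Y := by
  obtain ⟨I, S, G, a, b, ha, hb, hab⟩ :=
    exists_ultrafilter_realize_iff normLang card_normLang_le X N hXN
  have hnorm (q : ℚ) (s : S) : ∀ᶠ i in (G : Filter I), ‖a s i‖ ≤ q ↔ NormLE q (b s i) := by
    have := hab (Relations.formula₁ (L := normLang) (NormRel.normLE q) (Term.var s))
    simp only [realize_normLE_iff, normLE_iff_norm_le] at this
    exact this
  have hdist (q : ℚ) (s t : S) :
      ∀ᶠ i in (G : Filter I), dist (a s i) (a t i) ≤ q ↔ DistLE q (b s i) (b t i) := by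
    have := hab (Relations.formula₂ (L := normLang) (NormRel.distLE q) (Term.var s) (Term.var t))
    simp only [realize_distLE_iff, distLE_iff_dist_le] at this
    exact this
  have hfin {s : S} (hs : BddAlong G (a s)) :
      ∃ r : ℚ, ∀ᶠ i in (G : Filter I), NormLE r (b s i) := by
    obtain ⟨c, hc⟩ := hs
    obtain ⟨r, hr⟩ := exists_rat_gt c
    refine ⟨r, ?_⟩
    filter_upwards [hc, hnorm r s] with i h1 h2
    exact h2.1 (h1.trans hr.le)
  let w : S → I → Y := fun s i => j (b s i)
  have hw {s : S} (hs : BddAlong G (a s)) : BddAlong G (w s) := by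
    obtain ⟨r, hr⟩ := hfin hs
    exact ⟨r, hr.mono fun i hi => hj.norm_le hi⟩
  have hiso {s t : S} (hs : BddAlong G (a s)) (ht : BddAlong G (a t)) :
      dist (ultraOf G (w s)) (ultraOf G (w t)) = dist (ultraOf G (a s)) (ultraOf G (a t)) := by
    obtain ⟨r, hr⟩ := hfin hs
    obtain ⟨r', hr'⟩ := hfin ht
    apply le_antisymm
    · refine le_of_forall_gt_imp_ge_of_dense fun c hc => ?_
      obtain ⟨q, hq, hqc⟩ := exists_rat_btwn hc
      refine le_trans (dist_ultraOf_le (hw hs) (hw ht) ?_) hqc.le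
      filter_upwards [eventually_dist_lt_of_dist_ultraOf_lt hs ht hq, hdist q s t, hr, hr']
        with i h1 h2 h3 h4
      exact hj.dist_le h3 h4 (h2.1 h1.le)
    · refine le_of_forall_gt_imp_ge_of_dense fun c hc => ?_
      obtain ⟨q, hq, hqc⟩ := exists_rat_btwn hc
      refine le_trans (dist_ultraOf_le hs ht ?_) hqc.le
      filter_upwards [eventually_dist_lt_of_dist_ultraOf_lt (hw hs) (hw ht) hq, hdist q s t, hr,
        hr'] with i h1 h2 h3 h4
      refine h2.2 (by_contra fun h => ?_)
      exact h1.not_ge (hj.le_dist h3 h4 h)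
  have hex (u : Ultrapower I G X) : ∃ s, BddAlong G (a s) ∧ ultraOf G (a s) = u := by
    obtain ⟨z, hz, rfl⟩ := exists_bddAlong_ultraOf_eq u
    obtain ⟨s, rfl⟩ := ha z
    exact ⟨s, hz, rfl⟩
  choose σ hσ hσu using hex
  have hT (s : S) (hs : BddAlong G (a s)) :
      ultraOf G (w (σ (ultraOf G (a s)))) = ultraOf G (w s) := by
    rw [← dist_eq_zero, hiso (hσ _) hs, hσu, dist_self]
  refine ⟨I, G, nonempty_linearIsometryEquiv_of_dense (fun u => ultraOf G (w (σ u))) ?_ ?_ ?_⟩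
  · refine Isometry.of_dist_eq fun u v => ?_
    rw [hiso (hσ u) (hσ v), hσu, hσu]
  · obtain ⟨s, hs⟩ := ha fun _ => 0
    have hs' : ∀ᶠ i in (G : Filter I), ‖a s i‖ ≤ 0 := by simp [hs]
    have h0 : ultraOf G (a s) = 0 := norm_le_zero_iff.1 (norm_ultraOf_le hs')
    change ultraOf G (w (σ 0)) = 0
    rw [← h0, hT s ⟨0, hs'⟩]
    refine norm_le_zero_iff.1 (norm_ultraOf_le ?_)
    filter_upwards [hs', hnorm 0 s] with i h1 h2
    simpa using hj.norm_le (h2.1 (by simpa using h1))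
  · refine Metric.denseRange_iff.2 fun v ε hε => ?_
    obtain ⟨z, ⟨c, hc⟩, rfl⟩ := exists_bddAlong_ultraOf_eq v
    choose n r hn hnz using fun i => hj.dense (z i) (ε / 2) (half_pos hε)
    obtain ⟨s, rfl⟩ := hb n
    obtain ⟨q, hq⟩ := exists_rat_gt (c + ε / 2)
    have hs : BddAlong G (a s) := by
      refine ⟨q, ?_⟩
      filter_upwards [hc, hnorm q s] with i h1 h2
      refine h2.2 (by_contra fun h => ?_)
      have h3 := hj.le_norm (hn i) h
      have h4 := hnz i
      have h5 : ‖j (b s i)‖ ≤ ‖z i‖ + dist (j (b s i)) (z i) := by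
        rw [dist_eq_norm]
        exact norm_le_norm_add_norm_sub' _ _
      linarith
    refine ⟨ultraOf G (a s), ?_⟩
    rw [hT s hs, dist_comm]
    refine lt_of_le_of_lt (dist_ultraOf_le (hw hs) ⟨c, hc⟩ ?_) (half_lt_self hε)
    exact Filter.Eventually.of_forall fun i => (hnz i).le

end Transfer

section Model

open FirstOrder Language Cardinal

/-- An infinite-dimensional normed space has an ultrapower which contains a bounded separated
family of any prescribed cardinality. -/
theorem exists_separated_families {X : Type u} [NormedAddCommGroup X] [NormedSpace ℝ X]
    (hinf : ¬ FiniteDimensional ℝ X) (J : Type u) [Infinite J] :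
    ∃ (K : Type u) (U : Ultrafilter K) (R : ℝ) (f : J → K → X), (∀ j k, ‖f j k‖ ≤ R) ∧
      Pairwise fun i j => ∀ᶠ k in (U : Filter K), 1 ≤ dist (f i k) (f j k) := by
  classical
  obtain ⟨R, x, -, hxR, hx⟩ := exists_seq_norm_le_one_le_norm_sub (𝕜 := ℝ) hinf
  refine ⟨Finset J, Ultrafilter.of Filter.atTop, R,
    fun j s => if h : j ∈ s then x (s.equivFin ⟨j, h⟩) else 0, fun j s => ?_, fun i j hij => ?_⟩
  · dsimp only
    split_ifs
    · exact hxR _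
    · simpa using (norm_nonneg _).trans (hxR 0)
  · refine (Ultrafilter.of_le _) ?_
    filter_upwards [Filter.eventually_ge_atTop ({i, j} : Finset J)] with s hs
    have hi : i ∈ s := hs (by simp)
    have hj : j ∈ s := hs (by simp)
    rw [dif_pos hi, dif_pos hj, dist_eq_norm]
    refine hx fun h => hij ?_
    simpa using s.equivFin.injective (Fin.ext h)

theorem exists_isNormModel {X : Type u} [NormedAddCommGroup X] [NormedSpace ℝ X]
    [CompleteSpace X] (hinf : ¬ FiniteDimensional ℝ X) (κ : Cardinal.{u}) (hκ : ℵ₀ ≤ κ) :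
    ∃ (N : Type u) (_ : normLang.Structure N) (_ : Nonempty N) (Y : BanachSpace.{u})
      (j : N → Y.carrier), normLang.ElementarilyEquivalent X N ∧ IsNormModel j ∧
        bdim Y.carrier = κ := by
  obtain ⟨J, rfl⟩ : ∃ J : Type u, #J = κ := ⟨κ.out, κ.mk_out⟩
  have : Infinite J := Cardinal.infinite_iff.2 hκ
  obtain ⟨K, U, R, f, hfR, hf⟩ := exists_separated_families hinf J
  have hfB (i : J) : BddAlong U (f i) := ⟨R, Filter.Eventually.of_forall (hfR i)⟩
  let P := (U : Filter K).Product fun _ => X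
  let F : J → P := fun i => (f i : (U : Filter K).Product fun _ => X)
  have hF : Function.Injective F := by
    intro i k hik
    by_contra hne
    have h1 : ∀ᶠ s in (U : Filter K), f i s = f k s := Quotient.exact hik
    obtain ⟨s, h2, h3⟩ := (h1.and (hf hne)).exists
    rw [h2, dist_self] at h3
    norm_num at h3
  obtain ⟨N, hFN, hN⟩ := exists_elementarySubstructure_card_eq normLang (Set.range F) #J hκ
    (Cardinal.lift_le.2 mk_range_le)
    (by simpa using (Cardinal.lift_le.{u}.2 card_normLang_le).trans (by simp [hκ]))
    (Cardinal.lift_le.2 (mk_le_of_injective hF))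
  rw [Cardinal.lift_id, Cardinal.lift_id] at hN
  let rep : N → K → X := fun n => Quotient.out (n : P)
  have hrep (n : N) : ((rep n : K → X) : (U : Filter K).Product fun _ => X) = (n : P) :=
    Quotient.out_eq _
  have hnorm (q : ℚ) (n : N) : NormLE q n ↔ ∀ᶠ i in (U : Filter K), ‖rep n i‖ ≤ q := by
    rw [← normLE_product_iff, hrep]
    exact (normLE_map_iff N.subtype q n).symm
  have hdist (q : ℚ) (n m : N) :
      DistLE q n m ↔ ∀ᶠ i in (U : Filter K), dist (rep n i) (rep m i) ≤ q := by
    rw [← distLE_product_iff, hrep, hrep]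
    exact (distLE_map_iff N.subtype q n m).symm
  have hbdd (n : N) : BddAlong U (rep n) ↔ ∃ r : ℚ, NormLE r n := by
    constructor
    · rintro ⟨c, hc⟩
      obtain ⟨r, hr⟩ := exists_rat_gt c
      exact ⟨r, (hnorm r n).2 (hc.mono fun i hi => hi.trans hr.le)⟩
    · rintro ⟨r, hr⟩
      exact ⟨r, (hnorm r n).1 hr⟩
  let j₀ : N → Ultrapower K U X := fun n => ultraOf U (rep n)
  let V := (Submodule.span ℝ (Set.range j₀)).topologicalClosure
  have hj₀ (n : N) : j₀ n ∈ V :=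
    Submodule.le_topologicalClosure _ (Submodule.subset_span ⟨n, rfl⟩)
  let j : N → V := fun n => ⟨j₀ n, hj₀ n⟩
  have hcomb (p q : ℚ) {n m : N} (hn : BddAlong U (rep n)) (hm : BddAlong U (rep m)) :
      ∃ l : N, BddAlong U (rep l) ∧ j₀ l = (p : ℝ) • j₀ n + (q : ℝ) • j₀ m := by
    have h1 : ((rep (ratComb p q n m) : K → X) : (U : Filter K).Product fun _ => X) =
        ((fun i => (p : ℝ) • rep n i + (q : ℝ) • rep m i : K → X) :
          (U : Filter K).Product fun _ => X) := by
      rw [hrep, ← ratComb_product, hrep, hrep]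
      exact map_ratComb N.subtype p q n m
    have h2 : ∀ᶠ i in (U : Filter K),
        rep (ratComb p q n m) i = (p : ℝ) • rep n i + (q : ℝ) • rep m i := Quotient.exact h1
    refine ⟨ratComb p q n m, ?_, ?_⟩
    · obtain ⟨c, hc⟩ := hn.smul_add_smul hm p q
      refine ⟨c, ?_⟩
      filter_upwards [h2, hc] with i h3 h4
      rwa [h3]
    · exact (ultraOf_congr h2).trans (ultraOf_smul_add_smul hn hm _ _)
  have hrepF (i : J) (hi : F i ∈ N) : ∀ᶠ k in (U : Filter K), rep ⟨F i, hi⟩ k = f i k :=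
    Quotient.exact (hrep ⟨F i, hi⟩)
  let e : J → N := fun i => ⟨F i, hFN ⟨i, rfl⟩⟩
  have he (i : J) : j₀ (e i) = ultraOf U (f i) := ultraOf_congr (hrepF i _)
  have heB (i : J) : BddAlong U (rep (e i)) := by
    refine ⟨R, ?_⟩
    filter_upwards [hrepF i (hFN ⟨i, rfl⟩)] with k hk
    exact (congrArg norm hk).trans_le (hfR i k)
  let S : Set (Ultrapower K U X) := {u | ∃ n : N, BddAlong U (rep n) ∧ j₀ n = u}
  have hSc (p q : ℚ) (u : Ultrapower K U X) (hu : u ∈ S) (v : Ultrapower K U X) (hv : v ∈ S) :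
      (p : ℝ) • u + (q : ℝ) • v ∈ S := by
    obtain ⟨n, hn, rfl⟩ := hu
    obtain ⟨m, hm, rfl⟩ := hv
    exact hcomb p q hn hm
  have hS : S.Nonempty := ⟨_, e (Classical.arbitrary J), heB _, rfl⟩
  have hrange : Set.range j₀ ⊆ S := by
    rintro _ ⟨n, rfl⟩
    by_cases hn : BddAlong U (rep n)
    · exact ⟨n, hn, rfl⟩
    · obtain ⟨u, hu⟩ := hS
      have h0 := hSc 0 0 u hu u hu
      rw [show j₀ n = 0 from ultraOf_of_not_bddAlong hn]
      simpa using h0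
  have hdense (y : V) (ε : ℝ) (hε : 0 < ε) :
      ∃ (n : N) (r : ℚ), NormLE r n ∧ dist (j n) y < ε := by
    have h1 : (y : Ultrapower K U X) ∈ closure S := by
      have := closure_mono (Set.Subset.trans
        (SetLike.coe_subset_coe.2 (Submodule.span_mono (R := ℝ) hrange))
        (span_subset_closure_of_rat_combinations hS hSc)) y.2
      rwa [closure_closure] at this
    obtain ⟨_, ⟨n, hn, rfl⟩, hny⟩ := Metric.mem_closure_iff.1 h1 ε hε
    obtain ⟨r, hr⟩ := (hbdd n).1 hn
    exact ⟨n, r, hr, by rwa [dist_comm]⟩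
  refine ⟨N, inferInstance, ⟨e (Classical.arbitrary J)⟩, ⟨V⟩, j, ?_, ?_, ?_⟩
  · have hXP : normLang.ElementarilyEquivalent X P :=
      elementarilyEquivalent_iff.2 fun φ => by
        rw [Ultraproduct.sentence_realize, Filter.eventually_const]
    exact hXP.trans N.elementarilyEquivalent.symm
  · refine ⟨fun {q n} h => ?_, fun {q r n} hr h => ?_, fun {q r t n m} hr ht h => ?_,
      fun {q r t n m} hr ht h => ?_, hdense⟩
    · exact norm_ultraOf_le ((hnorm q n).1 h)
    · refine le_of_not_gt fun hlt => h ((hnorm q n).2 ?_)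
      exact (eventually_norm_lt_of_norm_ultraOf_lt ((hbdd n).2 ⟨r, hr⟩) hlt).mono
        fun i hi => hi.le
    · exact dist_ultraOf_le ((hbdd n).2 ⟨r, hr⟩) ((hbdd m).2 ⟨t, ht⟩) ((hdist q n m).1 h)
    · refine le_of_not_gt fun hlt => h ((hdist q n m).2 ?_)
      exact (eventually_dist_lt_of_dist_ultraOf_lt ((hbdd n).2 ⟨r, hr⟩)
        ((hbdd m).2 ⟨t, ht⟩) hlt).mono fun i hi => hi.le
  · apply le_antisymm
    · refine le_trans (csInf_le' ⟨Set.range j, rfl, ?_⟩) (mk_range_le.trans hN.le)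
      refine eq_top_iff.2 fun y _ => ?_
      refine closure_mono (Submodule.subset_span (R := ℝ)) ?_
      refine Metric.mem_closure_iff.2 fun ε hε => ?_
      obtain ⟨n, r, -, hn⟩ := hdense y ε hε
      exact ⟨j n, ⟨n, rfl⟩, by rwa [dist_comm]⟩
    · refine mk_le_bdim_of_separated (fun i => j (e i)) (fun i k hik => ?_) (R := R) fun i => ?_
      · change 1 ≤ dist (j₀ (e i)) (j₀ (e k))
        rw [he, he]
        refine le_of_not_gt fun hlt => ?_
        obtain ⟨s, h1, h2⟩ := ((hf hik).and
          (eventually_dist_lt_of_dist_ultraOf_lt (hfB i) (hfB k) hlt)).exists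
        exact h1.not_gt h2
      · change ‖j₀ (e i)‖ ≤ R
        rw [he]
        exact norm_ultraOf_le (Filter.Eventually.of_forall (hfR i))

end Model

/-- For every infinite-dimensional Banach space `X` and every infinite
cardinal `κ` there is a Banach space `Y` of dimension `κ` elementary equivalent to `X`. -/
theorem exists_elemEquiv_of_dim
    (X : Type u) [NormedAddCommGroup X] [NormedSpace ℝ X] [CompleteSpace X]
    (hinf : ¬ FiniteDimensional ℝ X)
    (κ : Cardinal.{u}) (hκ : Cardinal.aleph0 ≤ κ) :
    ∃ Y : BanachSpace.{u}, bdim Y.carrier = κ ∧ ElemEquiv X Y.carrier := by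
  obtain ⟨N, _, _, Y, j, hXN, hj, hY⟩ := exists_isNormModel hinf κ hκ
  exact ⟨Y, hY, elemEquiv_of_isNormModel hXN hj⟩
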